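/- For all μ, ν ∈ M(ℝ^d), WOP²(μ,ν) = (m_μ−m_ν)² + (m_μ−m_ν)(M_{x₀}(μ)−M_{x₀}(ν)) + m_μ m_ν W₂²(μ̄, ν̄). -/

import Mathlib

open MeasureTheory

noncomputable section

abbrev Euc (d : ℕ) := EuclideanSpace ℝ (Fin d)

variable {d : ℕ}

/-- Total mass of a measure. -/
def mass (μ : Measure (Euc d)) : ℝ := (μ Set.univ).toReal

/-- Second moment centered at `x₀`. -/
def sndMoment (x₀ : Euc d) (μ : Measure (Euc d)) : ℝ := ∫ x, ‖x - x₀‖ ^ 2 ∂μ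

/-- `μ ∈ M(ℝ^d)`: finite positive measure with finite second moment. -/
def MemM (μ : Measure (Euc d)) : Prop :=
  IsFiniteMeasure μ ∧ Integrable (fun x => ‖x‖ ^ 2) μ

/-- `μ ∈ P₂(ℝ^d)`: probability measure with finite second moment. -/
def MemP2 (μ : Measure (Euc d)) : Prop :=
  IsProbabilityMeasure μ ∧ Integrable (fun x => ‖x‖ ^ 2) μ

/-- Squared 2-Wasserstein distance, as an infimum over couplings. -/
def W2sq (μ ν : Measure (Euc d)) : ℝ :=
  sInf { r : ℝ | ∃ π : Measure (Euc d × Euc d),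
    π.map Prod.fst = μ ∧ π.map Prod.snd = ν ∧ r = ∫ p, ‖p.1 - p.2‖ ^ 2 ∂π }

/-- 2-Wasserstein distance. -/
def W2 (μ ν : Measure (Euc d)) : ℝ := Real.sqrt (W2sq μ ν)

/-- The dilation `T_a(x) = a (x - x₀) + x₀`. -/
def dil (x₀ : Euc d) (a : ℝ) (x : Euc d) : Euc d := a • (x - x₀) + x₀

/-- Normalization `μ̄` of `μ`, with the convention `μ̄ = δ_{x₀}` for the null measure. -/
def nm (x₀ : Euc d) (μ : Measure (Euc d)) : Measure (Euc d) :=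
  if μ Set.univ = 0 then Measure.dirac x₀ else (μ Set.univ)⁻¹ • μ

/-- Squared WOP metric with reference point `x₀`. -/
def WOP2 (x₀ : Euc d) (μ ν : Measure (Euc d)) : ℝ :=
  (mass μ - mass ν) ^ 2 +
    W2sq ((nm x₀ μ).map (dil x₀ (mass μ))) ((nm x₀ ν).map (dil x₀ (mass ν)))

/-- The WOP metric with reference point `x₀`. -/
def WOP (x₀ : Euc d) (μ ν : Measure (Euc d)) : ℝ := Real.sqrt (WOP2 x₀ μ ν)


theorem memLp_id_of_integrable_norm_sq {μ : Measure (Euc d)}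
    (hμ : Integrable (fun x => ‖x‖ ^ 2) μ) : MemLp id 2 μ :=
  (memLp_two_iff_integrable_sq_norm aestronglyMeasurable_id).2 hμ

theorem W2sq_comm (μ ν : Measure (Euc d)) : W2sq μ ν = W2sq ν μ := by
  have key : ∀ (μ ν : Measure (Euc d)) (r : ℝ),
      (∃ π : Measure (Euc d × Euc d),
        π.map Prod.fst = μ ∧ π.map Prod.snd = ν ∧ r = ∫ p, ‖p.1 - p.2‖ ^ 2 ∂π) →
      ∃ π : Measure (Euc d × Euc d),
        π.map Prod.fst = ν ∧ π.map Prod.snd = μ ∧ r = ∫ p, ‖p.1 - p.2‖ ^ 2 ∂π := by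
    rintro μ ν r ⟨π, rfl, rfl, rfl⟩
    refine ⟨π.map Prod.swap, ?_, ?_, ?_⟩
    · rw [Measure.map_map measurable_fst measurable_swap]; rfl
    · rw [Measure.map_map measurable_snd measurable_swap]; rfl
    · rw [integral_map measurable_swap.aemeasurable (by fun_prop)]
      simp [norm_sub_rev]
  unfold W2sq
  congr 1
  ext r
  exact ⟨key μ ν r, key ν μ r⟩

theorem W2sq_dirac_left (x₀ : Euc d) (ν : Measure (Euc d)) [IsProbabilityMeasure ν] :
    W2sq (Measure.dirac x₀) ν = sndMoment x₀ ν := by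
  have hset : { r : ℝ | ∃ π : Measure (Euc d × Euc d),
      π.map Prod.fst = Measure.dirac x₀ ∧ π.map Prod.snd = ν ∧ r = ∫ p, ‖p.1 - p.2‖ ^ 2 ∂π }
      = {sndMoment x₀ ν} := by
    have key : ∀ π : Measure (Euc d × Euc d), π.map Prod.fst = Measure.dirac x₀ →
        π.map Prod.snd = ν → ∫ p, ‖p.1 - p.2‖ ^ 2 ∂π = sndMoment x₀ ν := by
      rintro π h₁ rfl
      have hae : ∀ᵐ p ∂π, p.1 = x₀ := by
        refine ae_of_ae_map (p := fun x => x = x₀) measurable_fst.aemeasurable ?_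
        rw [h₁, ae_dirac_eq]
        exact rfl
      rw [sndMoment, integral_map measurable_snd.aemeasurable (by fun_prop)]
      refine integral_congr_ae ?_
      filter_upwards [hae] with p hp
      rw [hp, norm_sub_rev]
    refine Set.eq_singleton_iff_unique_mem.2 ⟨⟨(Measure.dirac x₀).prod ν, ?_, ?_, ?_⟩, ?_⟩
    · simp
    · simp
    · exact (key _ (by simp) (by simp)).symm
    · rintro r ⟨π, h₁, h₂, rfl⟩
      exact key π h₁ h₂
  rw [W2sq, hset, csInf_singleton]

theorem W2sq_map_homeomorph (μ ν : Measure (Euc d)) (e f : Euc d ≃ₜ Euc d) :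
    W2sq (μ.map e) (ν.map f) = sInf { r : ℝ | ∃ π : Measure (Euc d × Euc d),
      π.map Prod.fst = μ ∧ π.map Prod.snd = ν ∧ r = ∫ p, ‖e p.1 - f p.2‖ ^ 2 ∂π } := by
  have he := e.measurable
  have hf := f.measurable
  have he' := e.symm.measurable
  have hf' := f.symm.measurable
  unfold W2sq
  congr 1
  ext r
  constructor
  · rintro ⟨π, h₁, h₂, rfl⟩
    have hm : Measurable (Prod.map e.symm f.symm) := he'.prodMap hf'
    refine ⟨π.map (Prod.map e.symm f.symm), ?_, ?_, ?_⟩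
    · rw [Measure.map_map measurable_fst hm, Prod.map_fst',
        ← Measure.map_map he' measurable_fst, h₁, Measure.map_map he' he]
      simp
    · rw [Measure.map_map measurable_snd hm, Prod.map_snd',
        ← Measure.map_map hf' measurable_snd, h₂, Measure.map_map hf' hf]
      simp
    · rw [integral_map hm.aemeasurable (by fun_prop)]
      simp
  · rintro ⟨π, rfl, rfl, rfl⟩
    have hm : Measurable (Prod.map e f) := he.prodMap hf
    refine ⟨π.map (Prod.map e f), ?_, ?_, ?_⟩
    · rw [Measure.map_map measurable_fst hm, Prod.map_fst', Measure.map_map he measurable_fst]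
    · rw [Measure.map_map measurable_snd hm, Prod.map_snd', Measure.map_map hf measurable_snd]
    · rw [integral_map hm.aemeasurable (by fun_prop)]
      simp

/-- The dilation `dil x₀ a` with `a ≠ 0` as a homeomorphism. -/
def dilHomeomorph (x₀ : Euc d) (a : ℝ) (ha : a ≠ 0) : Euc d ≃ₜ Euc d where
  toFun := dil x₀ a
  invFun := dil x₀ a⁻¹
  left_inv x := by simp [dil, smul_smul, ha]
  right_inv x := by simp [dil, smul_smul, ha]
  continuous_toFun := by unfold dil; fun_prop
  continuous_invFun := by unfold dil; fun_prop

theorem norm_dil_sub_dil_sq (x₀ x y : Euc d) (a b : ℝ) :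
    ‖dil x₀ a x - dil x₀ b y‖ ^ 2 =
      (a - b) * (a * ‖x - x₀‖ ^ 2 - b * ‖y - x₀‖ ^ 2) + a * b * ‖x - y‖ ^ 2 := by
  have h₁ : dil x₀ a x - dil x₀ b y = a • (x - x₀) - b • (y - x₀) := by simp [dil]
  have h₂ : x - y = (x - x₀) - (y - x₀) := by abel
  rw [h₁, h₂, norm_sub_sq_real (a • _), norm_sub_sq_real (x - x₀), norm_smul, norm_smul, real_inner_smul_left,
    real_inner_smul_right, mul_pow, mul_pow, Real.norm_eq_abs, Real.norm_eq_abs, sq_abs, sq_abs]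
  ring

theorem integral_norm_dil_sub_dil_sq (x₀ : Euc d) (π : Measure (Euc d × Euc d))
    [IsFiniteMeasure π] (h₁ : MemLp id 2 (π.map Prod.fst)) (h₂ : MemLp id 2 (π.map Prod.snd))
    (a b : ℝ) :
    ∫ p, ‖dil x₀ a p.1 - dil x₀ b p.2‖ ^ 2 ∂π =
      (a - b) * (a * sndMoment x₀ (π.map Prod.fst) - b * sndMoment x₀ (π.map Prod.snd))
        + a * b * ∫ p, ‖p.1 - p.2‖ ^ 2 ∂π := by
  have l₁ : MemLp (fun p : Euc d × Euc d => p.1) 2 π :=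
    (memLp_map_measure_iff aestronglyMeasurable_id measurable_fst.aemeasurable).1 h₁
  have l₂ : MemLp (fun p : Euc d × Euc d => p.2) 2 π :=
    (memLp_map_measure_iff aestronglyMeasurable_id measurable_snd.aemeasurable).1 h₂
  have i₁ : Integrable (fun p : Euc d × Euc d => ‖p.1 - x₀‖ ^ 2) π :=
    (l₁.sub (memLp_const x₀)).integrable_norm_pow (by norm_num)
  have i₂ : Integrable (fun p : Euc d × Euc d => ‖p.2 - x₀‖ ^ 2) π :=
    (l₂.sub (memLp_const x₀)).integrable_norm_pow (by norm_num)
  have i₃ : Integrable (fun p : Euc d × Euc d => ‖p.1 - p.2‖ ^ 2) π :=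
    (l₁.sub l₂).integrable_norm_pow (by norm_num)
  simp_rw [norm_dil_sub_dil_sq]
  have i₄ : Integrable (fun p : Euc d × Euc d => a * ‖p.1 - x₀‖ ^ 2 - b * ‖p.2 - x₀‖ ^ 2) π :=
    (i₁.const_mul a).sub (i₂.const_mul b)
  rw [integral_add (i₄.const_mul _) (i₃.const_mul _),
    integral_const_mul, integral_const_mul,
    integral_sub (i₁.const_mul a) (i₂.const_mul b), integral_const_mul, integral_const_mul,
    sndMoment, sndMoment, integral_map measurable_fst.aemeasurable (by fun_prop),
    integral_map measurable_snd.aemeasurable (by fun_prop)]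

theorem W2sq_map_dil (x₀ : Euc d) (μ ν : Measure (Euc d)) [IsProbabilityMeasure μ]
    [IsProbabilityMeasure ν] (hμ : MemLp id 2 μ) (hν : MemLp id 2 ν) {a b : ℝ}
    (ha : 0 < a) (hb : 0 < b) :
    W2sq (μ.map (dil x₀ a)) (ν.map (dil x₀ b)) =
      (a - b) * (a * sndMoment x₀ μ - b * sndMoment x₀ ν) + a * b * W2sq μ ν := by
  set c := (a - b) * (a * sndMoment x₀ μ - b * sndMoment x₀ ν)
  have hcost : ∀ π : Measure (Euc d × Euc d), π.map Prod.fst = μ → π.map Prod.snd = ν →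
      ∫ p, ‖dil x₀ a p.1 - dil x₀ b p.2‖ ^ 2 ∂π = c + a * b * ∫ p, ‖p.1 - p.2‖ ^ 2 ∂π := by
    rintro π rfl rfl
    have : IsProbabilityMeasure π :=
      (Measure.isProbabilityMeasure_map_iff measurable_fst.aemeasurable).1 inferInstance
    exact integral_norm_dil_sub_dil_sq x₀ π hμ hν a b
  have hmono : Monotone fun r : ℝ => c + a * b * r := fun r s h => by
    have := mul_pos ha hb
    dsimp only
    gcongr
  refine (W2sq_map_homeomorph μ ν (dilHomeomorph x₀ a ha.ne') (dilHomeomorph x₀ b hb.ne')).trans ?_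
  refine Eq.trans ?_ (hmono.map_csInf_of_continuousAt (by fun_prop) ?_ ?_).symm
  · congr 1
    ext r
    constructor
    · rintro ⟨π, h₁, h₂, rfl⟩
      exact ⟨_, ⟨π, h₁, h₂, rfl⟩, (hcost π h₁ h₂).symm⟩
    · rintro ⟨_, ⟨π, h₁, h₂, rfl⟩, rfl⟩
      exact ⟨π, h₁, h₂, (hcost π h₁ h₂).symm⟩
  · exact ⟨_, μ.prod ν, by simp, by simp, rfl⟩
  · refine ⟨0, ?_⟩
    rintro r ⟨π, -, -, rfl⟩
    positivity

theorem sndMoment_map_dil (x₀ : Euc d) (μ : Measure (Euc d)) (a : ℝ) :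
    sndMoment x₀ (μ.map (dil x₀ a)) = a ^ 2 * sndMoment x₀ μ := by
  have hm : Measurable (dil x₀ a) := by unfold dil; fun_prop
  rw [sndMoment, integral_map hm.aemeasurable (by fun_prop), sndMoment, ← integral_const_mul]
  simp [dil, norm_smul, mul_pow]

theorem isProbabilityMeasure_nm (x₀ : Euc d) (μ : Measure (Euc d)) [IsFiniteMeasure μ] :
    IsProbabilityMeasure (nm x₀ μ) := by
  unfold nm
  split_ifs with h
  · infer_instance
  · exact ⟨by simp [ENNReal.inv_mul_cancel h (measure_ne_top μ _)]⟩

theorem memLp_id_nm (x₀ : Euc d) {μ : Measure (Euc d)} (hμ : MemM μ) :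
    MemLp id 2 (nm x₀ μ) := by
  unfold nm
  split_ifs with h
  · exact memLp_id_of_integrable_norm_sq (integrable_dirac (by simp))
  · exact (memLp_id_of_integrable_norm_sq hμ.2).smul_measure (ENNReal.inv_ne_top.2 h)

theorem mass_mul_sndMoment_nm (x₀ : Euc d) (μ : Measure (Euc d)) [IsFiniteMeasure μ] :
    mass μ * sndMoment x₀ (nm x₀ μ) = sndMoment x₀ μ := by
  by_cases h : μ Set.univ = 0
  · simp [mass, sndMoment, Measure.measure_univ_eq_zero.1 h]
  · have hm : (μ Set.univ).toReal ≠ 0 := ENNReal.toReal_ne_zero.2 ⟨h, measure_ne_top μ _⟩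
    simp only [nm, h, if_false, sndMoment, mass, integral_smul_measure, ENNReal.toReal_inv,
      smul_eq_mul]
    rw [mul_inv_cancel_left₀ hm]

theorem W2sq_map_dil_of_mass_eq_zero (x₀ : Euc d) {μ : Measure (Euc d)} (ν : Measure (Euc d))
    [IsFiniteMeasure ν] (hμ : μ Set.univ = 0) :
    W2sq ((nm x₀ μ).map (dil x₀ (mass μ))) ((nm x₀ ν).map (dil x₀ (mass ν))) =
      mass ν * sndMoment x₀ ν := by
  have hm : ∀ a, Measurable (dil x₀ a) := fun a => by unfold dil; fun_prop
  have := isProbabilityMeasure_nm x₀ ν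
  have := Measure.isProbabilityMeasure_map (μ := nm x₀ ν) (hm (mass ν)).aemeasurable
  have h : (nm x₀ μ).map (dil x₀ (mass μ)) = Measure.dirac x₀ := by
    rw [nm, if_pos hμ, Measure.map_dirac' (hm _)]
    simp [dil]
  rw [h, W2sq_dirac_left, sndMoment_map_dil, sq, mul_assoc, mass_mul_sndMoment_nm]

/-- reformulation of `WOP²` in terms of masses, second moments and
the Wasserstein distance between the normalized measures. -/
theorem WOP2_eq_massMomentW2 (d : ℕ) (x₀ : Euc d) (μ ν : Measure (Euc d))
    (hμ : MemM μ) (hν : MemM ν) :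
    WOP2 x₀ μ ν = (mass μ - mass ν) ^ 2
      + (mass μ - mass ν) * (sndMoment x₀ μ - sndMoment x₀ ν)
      + mass μ * mass ν * W2sq (nm x₀ μ) (nm x₀ ν) := by
  have := hμ.1
  have := hν.1
  have := isProbabilityMeasure_nm x₀ μ
  have := isProbabilityMeasure_nm x₀ ν
  rw [WOP2, add_assoc, add_right_inj]
  by_cases h : μ Set.univ = 0
  · have h₀ : mass μ = 0 := by simp [mass, h]
    have h₁ : sndMoment x₀ μ = 0 := by rw [← mass_mul_sndMoment_nm, h₀, zero_mul]
    rw [W2sq_map_dil_of_mass_eq_zero x₀ ν h, h₀, h₁]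
    ring
  by_cases h' : ν Set.univ = 0
  · have h₀ : mass ν = 0 := by simp [mass, h']
    have h₁ : sndMoment x₀ ν = 0 := by rw [← mass_mul_sndMoment_nm, h₀, zero_mul]
    rw [W2sq_comm, W2sq_map_dil_of_mass_eq_zero x₀ μ h', h₀, h₁]
    ring
  · have h₀ : 0 < mass μ := ENNReal.toReal_pos h (measure_ne_top μ _)
    have h₁ : 0 < mass ν := ENNReal.toReal_pos h' (measure_ne_top ν _)
    rw [W2sq_map_dil x₀ _ _ (memLp_id_nm x₀ hμ) (memLp_id_nm x₀ hν) h₀ h₁,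
      mass_mul_sndMoment_nm, mass_mul_sndMoment_nm]

end
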